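/- arXiv:1108.5949 — 2 statements merged into one kernel-verified Lean document; each statement's English description precedes it below -/
import Mathlib

section
/- Let k ≥ 1 and let v be any vertex of the graph L_k. Then γt(L_k − v) < γt(L_k). -/
open SimpleGraph

/-- The total domination number of a finite simple graph `G`: the minimum size of a set `S`
of vertices such that every vertex of `G` has a neighbor in `S`. -/
noncomputable def totalDominationNumber {V : Type*} [Fintype V] (G : SimpleGraph V) : ℕ :=
  sInf {n | ∃ S : Finset V, S.card = n ∧ ∀ v : V, ∃ u ∈ S, G.Adj v u}

/-- The almost total domination number of `G` with respect to `v`: the minimum size of a set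
`S` with `v ∈ S`, `v` having no neighbor in `S`, and every vertex other than `v` having a
neighbor in `S`. -/
noncomputable def almostTotalDominationNumber {V : Type*} [Fintype V] (G : SimpleGraph V)
    (v : V) : ℕ :=
  sInf {n | ∃ S : Finset V, S.card = n ∧ v ∈ S ∧ (∀ u ∈ S, ¬ G.Adj v u) ∧
    ∀ w : V, w ≠ v → ∃ u ∈ S, G.Adj w u}

/-- The graph obtained from `G` by deleting the vertex `v` and all incident edges. -/
def deleteVert {V : Type*} (G : SimpleGraph V) (v : V) : SimpleGraph {w : V // w ≠ v} :=
  G.induce {w : V | w ≠ v}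

/-- The cycle `C_n` on vertex set `Fin n`. -/
def cycleG (n : ℕ) : SimpleGraph (Fin n) :=
  SimpleGraph.fromRel (fun p q => (q : ℕ) = ((p : ℕ) + 1) % n)

/-- The 2-corona `C_k ∘ P_2` of the cycle `C_k`.  Vertex `(0, i)` is the cycle vertex `x_i`,
`(1, i)` is `x_i'` and `(2, i)` is `x_i''`, with pendant path `x_i x_i' x_i''`. -/
def coronaRel (k : ℕ) (p q : Fin 3 × Fin k) : Prop :=
  (p.1 = 0 ∧ q.1 = 0 ∧ (q.2 : ℕ) = ((p.2 : ℕ) + 1) % k) ∨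
  (p.1 = 0 ∧ q.1 = 1 ∧ p.2 = q.2) ∨
  (p.1 = 1 ∧ q.1 = 2 ∧ p.2 = q.2)

def coronaGraph (k : ℕ) : SimpleGraph (Fin 3 × Fin k) :=
  SimpleGraph.fromRel (coronaRel k)

/-- The edges of `G_k` common to `G_k`, `H_k`, `F_k`, `L_k` (0-indexed: `(0,i) = a_{i+1}`,
`(1,i) = b_{i+1}`, `(2,i) = c_{i+1}`, `(3,i) = d_{i+1}`): the two paths
`a_1 b_1 a_2 b_2 … a_k b_k` and `c_1 d_1 c_2 d_2 … c_k d_k`, and the edges `a_i d_i`,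
`b_i c_i`. -/
def gkBase (k : ℕ) (p q : Fin 4 × Fin k) : Prop :=
  (p.1 = 0 ∧ q.1 = 1 ∧ p.2 = q.2) ∨
  (p.1 = 1 ∧ q.1 = 0 ∧ (p.2 : ℕ) + 1 = (q.2 : ℕ)) ∨
  (p.1 = 2 ∧ q.1 = 3 ∧ p.2 = q.2) ∨
  (p.1 = 3 ∧ q.1 = 2 ∧ (p.2 : ℕ) + 1 = (q.2 : ℕ)) ∨
  (p.1 = 0 ∧ q.1 = 3 ∧ p.2 = q.2) ∨
  (p.1 = 1 ∧ q.1 = 2 ∧ p.2 = q.2)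

/-- The cubic graph `G_k`: the base edges together with `a_1 c_1` and `b_k d_k`. -/
def gkRel (k : ℕ) (p q : Fin 4 × Fin k) : Prop :=
  gkBase k p q ∨
  (p.1 = 0 ∧ q.1 = 2 ∧ (p.2 : ℕ) = 0 ∧ (q.2 : ℕ) = 0) ∨
  (p.1 = 1 ∧ q.1 = 3 ∧ (p.2 : ℕ) = k - 1 ∧ (q.2 : ℕ) = k - 1)

def GkGraph (k : ℕ) : SimpleGraph (Fin 4 × Fin k) :=
  SimpleGraph.fromRel (gkRel k)

/-- The cubic graph `H_k`: the base edges together with `a_1 b_k` and `c_1 d_k`. -/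
def hkRel (k : ℕ) (p q : Fin 4 × Fin k) : Prop :=
  gkBase k p q ∨
  (p.1 = 0 ∧ q.1 = 1 ∧ (p.2 : ℕ) = 0 ∧ (q.2 : ℕ) = k - 1) ∨
  (p.1 = 2 ∧ q.1 = 3 ∧ (p.2 : ℕ) = 0 ∧ (q.2 : ℕ) = k - 1)

def HkGraph (k : ℕ) : SimpleGraph (Fin 4 × Fin k) :=
  SimpleGraph.fromRel (hkRel k)

/-- Vertices of `F_k`: the vertices of `G_k` together with `v_1, v_2, v_3`
(encoded `Sum.inr 0`, `Sum.inr 1`, `Sum.inr 2`). -/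
abbrev FkVert (k : ℕ) := (Fin 4 × Fin k) ⊕ Fin 3

/-- `F_k` is obtained from `G_k` by subdividing the edge `a_1 c_1` three times,
giving the path `a_1 v_1 v_2 v_3 c_1`. -/
def fkRel (k : ℕ) (p q : FkVert k) : Prop :=
  match p, q with
  | Sum.inl p, Sum.inl q =>
      gkBase k p q ∨
      (p.1 = 1 ∧ q.1 = 3 ∧ (p.2 : ℕ) = k - 1 ∧ (q.2 : ℕ) = k - 1)
  | Sum.inl p, Sum.inr j =>
      (p.1 = 0 ∧ (p.2 : ℕ) = 0 ∧ j = 0) ∨ (p.1 = 2 ∧ (p.2 : ℕ) = 0 ∧ j = 2)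
  | Sum.inr i, Sum.inr j => (j : ℕ) = (i : ℕ) + 1
  | Sum.inr _, Sum.inl _ => False

def FkGraph (k : ℕ) : SimpleGraph (FkVert k) :=
  SimpleGraph.fromRel (fkRel k)

/-- Vertices of `L_k`: the vertices of `G_k` together with `v_1, v_2, v_3`
(encoded `Sum.inr (0, j)`) and `u_1, u_2, u_3` (encoded `Sum.inr (1, j)`). -/
abbrev LkVert (k : ℕ) := (Fin 4 × Fin k) ⊕ (Fin 2 × Fin 3)

/-- `L_k` is obtained from `G_k` by subdividing the edge `a_1 c_1` three times (path
`a_1 v_1 v_2 v_3 c_1`) and the edge `b_k d_k` three times (path `b_k u_1 u_2 u_3 d_k`). -/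
def lkRel (k : ℕ) (p q : LkVert k) : Prop :=
  match p, q with
  | Sum.inl p, Sum.inl q => gkBase k p q
  | Sum.inl p, Sum.inr j =>
      (p.1 = 0 ∧ (p.2 : ℕ) = 0 ∧ j = ((0 : Fin 2), (0 : Fin 3))) ∨
      (p.1 = 2 ∧ (p.2 : ℕ) = 0 ∧ j = ((0 : Fin 2), (2 : Fin 3))) ∨
      (p.1 = 1 ∧ (p.2 : ℕ) = k - 1 ∧ j = ((1 : Fin 2), (0 : Fin 3))) ∨
      (p.1 = 3 ∧ (p.2 : ℕ) = k - 1 ∧ j = ((1 : Fin 2), (2 : Fin 3)))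
  | Sum.inr i, Sum.inr j => i.1 = j.1 ∧ (j.2 : ℕ) = (i.2 : ℕ) + 1
  | Sum.inr _, Sum.inl _ => False

def LkGraph (k : ℕ) : SimpleGraph (LkVert k) :=
  SimpleGraph.fromRel (lkRel k)

/-- The generalized Petersen graph `GP(8,3)` of order 16: `(0, i) = u_i`, `(1, i) = w_i`. -/
def gpRel (p q : Fin 2 × Fin 8) : Prop :=
  (p.1 = 0 ∧ q.1 = 0 ∧ (q.2 : ℕ) = ((p.2 : ℕ) + 1) % 8) ∨
  (p.1 = 0 ∧ q.1 = 1 ∧ p.2 = q.2) ∨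
  (p.1 = 1 ∧ q.1 = 1 ∧ (q.2 : ℕ) = ((p.2 : ℕ) + 3) % 8)

def GP16 : SimpleGraph (Fin 2 × Fin 8) :=
  SimpleGraph.fromRel gpRel

/-- A two-row covering bound: if column `0` is hit, each later entry is hit by its own column
or by the preceding entry of its row, and every entry of the last column is hit or covered by
`w`, then the total weight is at least the number of columns plus one. -/
theorem add_two_le_sum_of_cover (k : ℕ) (x y : Fin (k + 1) → ℕ) (w : ℕ)
    (h0 : 1 ≤ x 0 + y 0)
    (hx : ∀ i : Fin k, 1 ≤ x i.castSucc + (x i.succ + y i.succ))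
    (hy : ∀ i : Fin k, 1 ≤ y i.castSucc + (x i.succ + y i.succ))
    (hxw : 1 ≤ x (Fin.last k) + w) (hyw : 1 ≤ y (Fin.last k) + w) :
    k + 2 ≤ ∑ i, (x i + y i) + w := by
  have key : k + 1 ≤ ∑ i, (x i + y i) ∧
      (1 ≤ x (Fin.last k) → 1 ≤ y (Fin.last k) → k + 2 ≤ ∑ i, (x i + y i)) := by
    clear hxw hyw
    induction k with
    | zero => simp; omega
    | succ n ih =>
      have := ih (fun i => x i.castSucc) (fun i => y i.castSucc) h0
        (fun i => hx i.castSucc) (fun i => hy i.castSucc)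
      have h1 := hx (Fin.last n)
      have h2 := hy (Fin.last n)
      simp only [Fin.succ_last, Nat.succ_eq_add_one] at h1 h2
      rw [Fin.sum_univ_castSucc]
      omega
  omega

/-- The reflection of `L_k` exchanging `a_i` with `b_{k+1-i}`, `c_i` with `d_{k+1-i}` and `v_j`
with `u_j`. -/
def lkFlip (k : ℕ) : LkVert k → LkVert k
  | Sum.inl (t, i) => Sum.inl (![1, 0, 3, 2] t, i.rev)
  | Sum.inr (s, j) => Sum.inr (s.rev, j)

/-- The reflection of `L_k` exchanging `a_i` with `c_i`, `b_i` with `d_i`, `v_1` with `v_3` and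
`u_1` with `u_3`. -/
def lkSwap (k : ℕ) : LkVert k → LkVert k
  | Sum.inl (t, i) => Sum.inl (![2, 3, 0, 1] t, i)
  | Sum.inr (s, j) => Sum.inr (s, j.rev)

theorem lkFlip_involutive (k : ℕ) : Function.Involutive (lkFlip k) := by
  rintro (⟨t, i⟩ | ⟨s, j⟩)
  · fin_cases t <;> simp [lkFlip]
  · simp [lkFlip]

theorem lkSwap_involutive (k : ℕ) : Function.Involutive (lkSwap k) := by
  rintro (⟨t, i⟩ | ⟨s, j⟩)
  · fin_cases t <;> simp [lkSwap]
  · simp [lkSwap]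

theorem LkGraph_adj_lkFlip {k : ℕ} {p q : LkVert k} (h : (LkGraph k).Adj p q) :
    (LkGraph k).Adj (lkFlip k p) (lkFlip k q) := by
  obtain ⟨hne, h⟩ := h
  refine ⟨(lkFlip_involutive k).injective.ne hne, ?_⟩
  clear hne
  rcases p with ⟨t, i, hi⟩ | ⟨s, j⟩ <;> rcases q with ⟨t', i', hi'⟩ | ⟨s', j'⟩
  · fin_cases t <;> fin_cases t' <;>
      simp [lkFlip, lkRel, gkBase, Fin.ext_iff] at h ⊢ <;> omega
  · fin_cases t <;> fin_cases s' <;> fin_cases j' <;>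
      simp [lkFlip, lkRel, Fin.ext_iff] at h ⊢ <;> omega
  · fin_cases t' <;> fin_cases s <;> fin_cases j <;>
      simp [lkFlip, lkRel, Fin.ext_iff] at h ⊢ <;> omega
  · simpa [lkFlip, lkRel] using h

theorem LkGraph_adj_lkSwap {k : ℕ} {p q : LkVert k} (h : (LkGraph k).Adj p q) :
    (LkGraph k).Adj (lkSwap k p) (lkSwap k q) := by
  obtain ⟨hne, h⟩ := h
  refine ⟨(lkSwap_involutive k).injective.ne hne, ?_⟩
  clear hne
  rcases p with ⟨t, i, hi⟩ | ⟨s, j⟩ <;> rcases q with ⟨t', i', hi'⟩ | ⟨s', j'⟩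
  · fin_cases t <;> fin_cases t' <;>
      simp [lkSwap, lkRel, gkBase, Fin.ext_iff] at h ⊢ <;> omega
  · fin_cases t <;> fin_cases s' <;> fin_cases j' <;>
      simp [lkSwap, lkRel, Fin.ext_iff] at h ⊢ <;> omega
  · fin_cases t' <;> fin_cases s <;> fin_cases j <;>
      simp [lkSwap, lkRel, Fin.ext_iff] at h ⊢ <;> omega
  · simp only [lkSwap, lkRel, Fin.val_rev] at h ⊢
    omega

/-- `S` avoids `v` and totally dominates every vertex other than `v`. -/
def IsTotalDominatingAway {V : Type*} (G : SimpleGraph V) (v : V) (S : Finset V) : Prop :=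
  v ∉ S ∧ ∀ w, w ≠ v → ∃ u ∈ S, G.Adj w u

theorem IsTotalDominatingAway.image {V : Type*} [DecidableEq V] {G : SimpleGraph V} {v : V}
    {S : Finset V} {f : V → V} (hf : Function.Involutive f)
    (hadj : ∀ {p q}, G.Adj p q → G.Adj (f p) (f q)) (h : IsTotalDominatingAway G (f v) S) :
    IsTotalDominatingAway G v (S.image f) := by
  refine ⟨fun hv => h.1 ?_, fun w hw => ?_⟩
  · obtain ⟨u, hu, rfl⟩ := Finset.mem_image.1 hv
    rwa [hf u]
  · obtain ⟨u, hu, huw⟩ := h.2 (f w) (hf.injective.ne hw)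
    exact ⟨f u, Finset.mem_image_of_mem f hu, by simpa [hf w] using hadj huw⟩

theorem totalDominationNumber_deleteVert_le {V : Type*} [Fintype V] [DecidableEq V]
    {G : SimpleGraph V} {v : V} [Fintype {w : V // w ≠ v}] {S : Finset V}
    (h : IsTotalDominatingAway G v S) :
    totalDominationNumber (deleteVert G v) ≤ S.card := by
  have hdom : ∀ w : {w : V // w ≠ v}, ∃ u ∈ S.subtype (· ≠ v), (deleteVert G v).Adj w u := by
    rintro ⟨w, hw⟩
    obtain ⟨u, hu, huw⟩ := h.2 w hw
    exact ⟨⟨u, fun e => h.1 (e ▸ hu)⟩, by simpa using hu, huw⟩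
  calc totalDominationNumber (deleteVert G v) ≤ (S.subtype (· ≠ v)).card :=
        Nat.sInf_le ⟨_, rfl, hdom⟩
    _ ≤ S.card := by
        rw [Finset.card_subtype]
        exact Finset.card_filter_le _ _

/-- A total dominating set of `L_k - a_i`: it consists of `v_2, v_3, u_2, u_3`, all `c_j`, the
`d_j` with `j < i` and the `b_j` with `i < j`. -/
def lkAwayA {k : ℕ} (i : Fin k) : Finset (LkVert k) :=
  ({Sum.inr (0, 1), Sum.inr (0, 2), Sum.inr (1, 1), Sum.inr (1, 2)} ∪
    Finset.univ.image (fun j : Fin k => Sum.inl (2, j))) ∪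
    (Finset.univ.erase i).image
      (fun j : Fin k => if j < i then Sum.inl (3, j) else Sum.inl (1, j))

theorem exists_isTotalDominatingAway_a {k : ℕ} (i : Fin k) :
    ∃ S : Finset (LkVert k), S.card ≤ 2 * k + 3 ∧
      IsTotalDominatingAway (LkGraph k) (Sum.inl (0, i)) S := by
  refine ⟨lkAwayA i, ?_, ?_, ?_⟩
  · have hk : 0 < k := i.pos
    refine (Finset.card_union_le _ _).trans ?_
    have h1 := Finset.card_union_le
      ({Sum.inr (0, 1), Sum.inr (0, 2), Sum.inr (1, 1), Sum.inr (1, 2)} : Finset (LkVert k))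
      (Finset.univ.image (fun j : Fin k => Sum.inl (2, j)))
    have h2 := Finset.card_image_le (s := Finset.univ.erase i)
      (f := fun j : Fin k => (if j < i then Sum.inl (3, j) else Sum.inl (1, j) : LkVert k))
    have h3 := Finset.card_image_le (s := Finset.univ)
      (f := fun j : Fin k => (Sum.inl (2, j) : LkVert k))
    have h4 := Finset.card_le_four (a := (Sum.inr (0, 1) : LkVert k)) (b := Sum.inr (0, 2))
      (c := Sum.inr (1, 1)) (d := Sum.inr (1, 2))
    simp only [Finset.card_erase_of_mem (Finset.mem_univ i), Finset.card_univ,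
      Fintype.card_fin] at h2 h3
    omega
  · simp only [lkAwayA, Finset.mem_union, Finset.mem_image, not_or]
    refine ⟨⟨by simp, by simp⟩, ?_⟩
    rintro ⟨j, -, hj⟩
    split_ifs at hj <;> simp at hj
  · have hc : ∀ j : Fin k, Sum.inl (2, j) ∈ lkAwayA i := by
      simp [lkAwayA]
    have hd : ∀ j : Fin k, j < i → Sum.inl (3, j) ∈ lkAwayA i := fun j hj =>
      Finset.mem_union_right _ (Finset.mem_image.2 ⟨j, by simp [hj.ne], by simp [hj]⟩)
    have hb : ∀ j : Fin k, i < j → Sum.inl (1, j) ∈ lkAwayA i := fun j hj =>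
      Finset.mem_union_right _ (Finset.mem_image.2 ⟨j, by simp [hj.ne'], by simp [hj.le]⟩)
    rintro (⟨t, j⟩ | ⟨s, j⟩) hw
    · fin_cases t
      · rcases lt_trichotomy j i with hj | rfl | hj
        · exact ⟨_, hd j hj, by simp [LkGraph, lkRel, gkBase]⟩
        · exact absurd rfl hw
        · exact ⟨_, hb j hj, by simp [LkGraph, lkRel, gkBase]⟩
      · exact ⟨_, hc j, by simp [LkGraph, lkRel, gkBase]⟩
      · rcases lt_trichotomy j i with hj | rfl | hj
        · exact ⟨_, hd j hj, by simp [LkGraph, lkRel, gkBase]⟩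
        · rcases j with ⟨_ | j, hj⟩
          · exact ⟨Sum.inr (0, 2), by simp [lkAwayA], by simp [LkGraph, lkRel]⟩
          · exact ⟨_, hd ⟨j, by omega⟩ (by simp [Fin.lt_def]), by
              simp [LkGraph, lkRel, gkBase]⟩
        · exact ⟨_, hb j hj, by simp [LkGraph, lkRel, gkBase]⟩
      · exact ⟨_, hc j, by simp [LkGraph, lkRel, gkBase]⟩
    · fin_cases s <;> fin_cases j
      · exact ⟨Sum.inr (0, 1), by simp [lkAwayA], by simp [LkGraph, lkRel]⟩
      · exact ⟨Sum.inr (0, 2), by simp [lkAwayA], by simp [LkGraph, lkRel]⟩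
      · exact ⟨Sum.inr (0, 1), by simp [lkAwayA], by simp [LkGraph, lkRel]⟩
      · exact ⟨Sum.inr (1, 1), by simp [lkAwayA], by simp [LkGraph, lkRel]⟩
      · exact ⟨Sum.inr (1, 2), by simp [lkAwayA], by simp [LkGraph, lkRel]⟩
      · exact ⟨Sum.inr (1, 1), by simp [lkAwayA], by simp [LkGraph, lkRel]⟩

theorem card_three_union_two_rows_le {k : ℕ} (x y z : LkVert k) (s t : Fin 4) :
    (({x, y, z} : Finset (LkVert k)) ∪ ({s, t} ×ˢ Finset.univ).map .inl).card ≤ 2 * k + 3 := by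
  have h1 := Finset.card_union_le ({x, y, z} : Finset (LkVert k))
    ((({s, t} : Finset (Fin 4)) ×ˢ (Finset.univ : Finset (Fin k))).map .inl)
  have h2 : ({x, y, z} : Finset (LkVert k)).card ≤ 3 := Finset.card_le_three
  have h3 : ({s, t} : Finset (Fin 4)).card ≤ 2 := Finset.card_le_two
  rw [Finset.card_map, Finset.card_product, Finset.card_univ, Fintype.card_fin] at h1
  have h4 := Nat.mul_le_mul_right k h3
  omega

theorem exists_isTotalDominatingAway_v₂ {k : ℕ} (hk : 1 ≤ k) :
    ∃ S : Finset (LkVert k), S.card ≤ 2 * k + 3 ∧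
      IsTotalDominatingAway (LkGraph k) (Sum.inr (0, 1)) S := by
  refine ⟨_, card_three_union_two_rows_le (Sum.inr (1, 1)) (Sum.inr (1, 0))
    (Sum.inl (2, ⟨0, hk⟩)) 0 1, by simp, ?_⟩
  rintro (⟨t, j⟩ | ⟨s, j⟩) hw
  · fin_cases t
    · exact ⟨Sum.inl (1, j), by simp, by simp [LkGraph, lkRel, gkBase]⟩
    · exact ⟨Sum.inl (0, j), by simp, by simp [LkGraph, lkRel, gkBase]⟩
    · exact ⟨Sum.inl (1, j), by simp, by simp [LkGraph, lkRel, gkBase]⟩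
    · exact ⟨Sum.inl (0, j), by simp, by simp [LkGraph, lkRel, gkBase]⟩
  · fin_cases s <;> fin_cases j
    · exact ⟨Sum.inl (0, ⟨0, hk⟩), by simp, by simp [LkGraph, lkRel]⟩
    · exact absurd rfl hw
    · exact ⟨Sum.inl (2, ⟨0, hk⟩), by simp, by simp [LkGraph, lkRel]⟩
    · exact ⟨Sum.inr (1, 1), by simp, by simp [LkGraph, lkRel]⟩
    · exact ⟨Sum.inr (1, 0), by simp, by simp [LkGraph, lkRel]⟩
    · exact ⟨Sum.inr (1, 1), by simp, by simp [LkGraph, lkRel]⟩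

theorem exists_isTotalDominatingAway_u₁ {k : ℕ} (hk : 1 ≤ k) :
    ∃ S : Finset (LkVert k), S.card ≤ 2 * k + 3 ∧
      IsTotalDominatingAway (LkGraph k) (Sum.inr (1, 0)) S := by
  refine ⟨_, card_three_union_two_rows_le (Sum.inr (0, 0)) (Sum.inr (0, 1))
    (Sum.inr (1, 2)) 2 3, by simp, ?_⟩
  rintro (⟨t, j⟩ | ⟨s, j⟩) hw
  · fin_cases t
    · exact ⟨Sum.inl (3, j), by simp, by simp [LkGraph, lkRel, gkBase]⟩
    · exact ⟨Sum.inl (2, j), by simp, by simp [LkGraph, lkRel, gkBase]⟩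
    · exact ⟨Sum.inl (3, j), by simp, by simp [LkGraph, lkRel, gkBase]⟩
    · exact ⟨Sum.inl (2, j), by simp, by simp [LkGraph, lkRel, gkBase]⟩
  · fin_cases s <;> fin_cases j
    · exact ⟨Sum.inr (0, 1), by simp, by simp [LkGraph, lkRel]⟩
    · exact ⟨Sum.inr (0, 0), by simp, by simp [LkGraph, lkRel]⟩
    · exact ⟨Sum.inr (0, 1), by simp, by simp [LkGraph, lkRel]⟩
    · exact absurd rfl hw
    · exact ⟨Sum.inr (1, 2), by simp, by simp [LkGraph, lkRel]⟩
    · exact ⟨Sum.inl (3, ⟨k - 1, by omega⟩), by simp, by simp [LkGraph, lkRel]⟩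

theorem exists_isTotalDominatingAway {k : ℕ} (hk : 1 ≤ k) (v : LkVert k) :
    ∃ S : Finset (LkVert k), S.card ≤ 2 * k + 3 ∧ IsTotalDominatingAway (LkGraph k) v S := by
  have hflip : ∀ v, (∃ S : Finset (LkVert k), S.card ≤ 2 * k + 3 ∧
      IsTotalDominatingAway (LkGraph k) (lkFlip k v) S) →
      ∃ S : Finset (LkVert k), S.card ≤ 2 * k + 3 ∧ IsTotalDominatingAway (LkGraph k) v S :=
    fun v ⟨_, hc, hS⟩ => ⟨_, Finset.card_image_le.trans hc,
      hS.image (lkFlip_involutive k) LkGraph_adj_lkFlip⟩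
  have hswap : ∀ v, (∃ S : Finset (LkVert k), S.card ≤ 2 * k + 3 ∧
      IsTotalDominatingAway (LkGraph k) (lkSwap k v) S) →
      ∃ S : Finset (LkVert k), S.card ≤ 2 * k + 3 ∧ IsTotalDominatingAway (LkGraph k) v S :=
    fun v ⟨_, hc, hS⟩ => ⟨_, Finset.card_image_le.trans hc,
      hS.image (lkSwap_involutive k) LkGraph_adj_lkSwap⟩
  rcases v with ⟨t, i⟩ | ⟨s, j⟩
  · fin_cases t
    · exact exists_isTotalDominatingAway_a i
    · exact hflip _ (exists_isTotalDominatingAway_a i.rev)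
    · exact hswap _ (exists_isTotalDominatingAway_a i)
    · exact hswap _ (hflip _ (exists_isTotalDominatingAway_a i.rev))
  · fin_cases s <;> fin_cases j
    · exact hflip _ (exists_isTotalDominatingAway_u₁ hk)
    · exact exists_isTotalDominatingAway_v₂ hk
    · exact hflip _ (hswap _ (exists_isTotalDominatingAway_u₁ hk))
    · exact exists_isTotalDominatingAway_u₁ hk
    · exact hflip _ (exists_isTotalDominatingAway_v₂ hk)
    · exact hswap _ (exists_isTotalDominatingAway_u₁ hk)

/-- A weight function on `L_k` that is positive somewhere on each neighborhood has total weight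
at least `k + 2` on the bipartition class of the vertices `b_i`, `d_i`, `v_1`, `v_3`, `u_2`. -/
theorem add_two_le_sum_class {k : ℕ} (hk : 1 ≤ k) (e : LkVert k → ℕ)
    (h : ∀ v, ∃ u, (LkGraph k).Adj v u ∧ 1 ≤ e u) :
    k + 2 ≤ ∑ i, (e (Sum.inl (1, i)) + e (Sum.inl (3, i))) +
      e (Sum.inr (0, 0)) + e (Sum.inr (0, 2)) + e (Sum.inr (1, 1)) := by
  obtain ⟨n, rfl⟩ : ∃ n, k = n + 1 := ⟨k - 1, by omega⟩
  have key := add_two_le_sum_of_cover (n + 1)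
    (Fin.cons (e (Sum.inr (0, 0))) fun i => e (Sum.inl (1, i)))
    (Fin.cons (e (Sum.inr (0, 2))) fun i => e (Sum.inl (3, i))) (e (Sum.inr (1, 1)))
    ?_ ?_ ?_ ?_ ?_
  · rw [Fin.sum_univ_succ] at key
    simp only [Fin.cons_zero, Fin.cons_succ] at key
    omega
  · obtain ⟨⟨t, j⟩ | ⟨s, j⟩, hadj, hu⟩ := h (Sum.inr (0, 1))
    · simp [LkGraph, lkRel] at hadj
    · fin_cases s <;> fin_cases j <;> simp [LkGraph, lkRel] at hadj hu ⊢ <;> omega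
  · refine Fin.cases ?_ fun i => ?_
    · obtain ⟨⟨t, j⟩ | ⟨s, j⟩, hadj, hu⟩ := h (Sum.inl (0, 0))
      · fin_cases t <;> simp [LkGraph, lkRel, gkBase] at hadj hu ⊢ <;> (subst hadj; omega)
      · fin_cases s <;> fin_cases j <;> simp [LkGraph, lkRel] at hadj hu ⊢
        omega
    · obtain ⟨⟨t, j⟩ | ⟨s, j⟩, hadj, hu⟩ := h (Sum.inl (0, i.succ))
      · fin_cases t <;> simp [LkGraph, lkRel, gkBase] at hadj hu ⊢
        · rcases hadj with rfl | hadj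
          · omega
          · obtain rfl : j = i.castSucc := Fin.ext hadj
            omega
        · subst hadj; omega
      · simp [LkGraph, lkRel] at hadj
  · refine Fin.cases ?_ fun i => ?_
    · obtain ⟨⟨t, j⟩ | ⟨s, j⟩, hadj, hu⟩ := h (Sum.inl (2, 0))
      · fin_cases t <;> simp [LkGraph, lkRel, gkBase] at hadj hu ⊢ <;> (subst hadj; omega)
      · fin_cases s <;> fin_cases j <;> simp [LkGraph, lkRel] at hadj hu ⊢
        omega
    · obtain ⟨⟨t, j⟩ | ⟨s, j⟩, hadj, hu⟩ := h (Sum.inl (2, i.succ))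
      · fin_cases t <;> simp [LkGraph, lkRel, gkBase] at hadj hu ⊢
        · subst hadj; omega
        · rcases hadj with rfl | hadj
          · omega
          · obtain rfl : j = i.castSucc := Fin.ext hadj
            omega
      · simp [LkGraph, lkRel] at hadj
  · rw [← Fin.succ_last, Fin.cons_succ]
    obtain ⟨⟨t, j⟩ | ⟨s, j⟩, hadj, hu⟩ := h (Sum.inr (1, 0))
    · fin_cases t <;> simp [LkGraph, lkRel] at hadj hu ⊢
      obtain rfl : j = Fin.last n := Fin.ext hadj
      omega
    · fin_cases s <;> fin_cases j <;> simp [LkGraph, lkRel] at hadj hu ⊢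
      omega
  · rw [← Fin.succ_last, Fin.cons_succ]
    obtain ⟨⟨t, j⟩ | ⟨s, j⟩, hadj, hu⟩ := h (Sum.inr (1, 2))
    · fin_cases t <;> simp [LkGraph, lkRel] at hadj hu ⊢
      obtain rfl : j = Fin.last n := Fin.ext hadj
      omega
    · fin_cases s <;> fin_cases j <;> simp [LkGraph, lkRel] at hadj hu ⊢
      omega

theorem two_mul_add_four_le_sum {k : ℕ} (hk : 1 ≤ k) (e : LkVert k → ℕ)
    (h : ∀ v, ∃ u, (LkGraph k).Adj v u ∧ 1 ≤ e u) : 2 * k + 4 ≤ ∑ u, e u := by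
  have h1 := add_two_le_sum_class hk e h
  have h2 := add_two_le_sum_class hk (fun u => e (lkFlip k u)) fun v => by
    obtain ⟨u, huv, hu⟩ := h (lkFlip k v)
    exact ⟨lkFlip k u, by simpa [lkFlip_involutive k v] using LkGraph_adj_lkFlip huv,
      by simpa [lkFlip_involutive k u] using hu⟩
  have ha : ∑ i, e (lkFlip k (Sum.inl (1, i))) = ∑ i, e (Sum.inl (0, i)) :=
    Equiv.sum_comp Fin.revPerm fun i => e (Sum.inl (0, i))
  have hc : ∑ i, e (lkFlip k (Sum.inl (3, i))) = ∑ i, e (Sum.inl (2, i)) :=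
    Equiv.sum_comp Fin.revPerm fun i => e (Sum.inl (2, i))
  rw [Finset.sum_add_distrib] at h1 h2
  rw [ha, hc] at h2
  simp only [Fintype.sum_sum_type, Fintype.sum_prod_type, Fin.sum_univ_four, Fin.sum_univ_three,
    Fin.sum_univ_two]
  change _ ≤ _ + e (Sum.inr (1, 0)) + e (Sum.inr (1, 2)) + e (Sum.inr (0, 1)) at h2
  omega

theorem two_mul_add_four_le_card {k : ℕ} (hk : 1 ≤ k) (S : Finset (LkVert k))
    (hS : ∀ v, ∃ u ∈ S, (LkGraph k).Adj v u) : 2 * k + 4 ≤ S.card := by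
  simpa using two_mul_add_four_le_sum hk (fun u => if u ∈ S then 1 else 0) fun v =>
    let ⟨u, hu, huv⟩ := hS v
    ⟨u, huv, by simp [hu]⟩

/-- For `k ≥ 1` and any vertex `v` of `L_k`, `γt(L_k − v) < γt(L_k)`. -/
theorem Lk_deleteVert (k : ℕ) (hk : 1 ≤ k) (v : LkVert k) :
    totalDominationNumber (deleteVert (LkGraph k) v) <
      totalDominationNumber (LkGraph k) := by
  have hne : ∀ w : LkVert k, ∃ u, (LkGraph k).Adj w u := by
    intro w
    obtain ⟨z, hz⟩ : ∃ z : LkVert k, w ≠ z := by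
      by_cases h : w = Sum.inr (0, 0)
      · exact ⟨Sum.inr (0, 1), by simp [h]⟩
      · exact ⟨_, h⟩
    obtain ⟨S, -, hS⟩ := exists_isTotalDominatingAway hk z
    obtain ⟨u, -, hu⟩ := hS.2 w hz
    exact ⟨u, hu⟩
  obtain ⟨S, hc, hS⟩ := exists_isTotalDominatingAway hk v
  calc totalDominationNumber (deleteVert (LkGraph k) v) ≤ S.card :=
        totalDominationNumber_deleteVert_le hS
    _ < 2 * k + 4 := by omega
    _ ≤ totalDominationNumber (LkGraph k) := by
        refine le_csInf ⟨_, Finset.univ, rfl, fun w => ?_⟩ ?_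
        · simpa using hne w
        · rintro _ ⟨T, rfl, hT⟩
          exact two_mul_add_four_le_card hk T hT
end

section
/- The generalized Petersen graph GP_16 = GP(8,3), a cubic graph of order 16, has total domination number γt(GP_16) = 8, i.e., its total domination number is exactly one-half its order. -/
open SimpleGraph

instance : DecidableRel GP16.Adj := fun p q => by
  unfold GP16 gpRel
  simp only [SimpleGraph.fromRel_adj]
  infer_instance

/-- `GP16` is bipartite, with the parity of the sum of the coordinates as colouring; every vertex
of one colour is adjacent only to vertices of the other colour `p`, at the indices listed. -/
theorem GP16_adj_opposite_color : ∀ (p : Fin 2) (i : Fin 8) (u : Fin 2 × Fin 8),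
    GP16.Adj (if (i : ℕ) % 2 = p then 1 else 0, i) u →
      ((u.1 : ℕ) + u.2) % 2 = p ∧
        (if (i : ℕ) % 2 = p then u.2 = i ∨ u.2 = i + 3 ∨ u.2 = i - 3
          else u.2 = i ∨ u.2 = i + 1 ∨ u.2 = i - 1) := by
  decide

theorem four_le_card_of_cover : ∀ (p : Fin 2) (T : Finset (Fin 8)),
    (∀ i : Fin 8, if (i : ℕ) % 2 = p then i ∈ T ∨ i + 3 ∈ T ∨ i - 3 ∈ T
      else i ∈ T ∨ i + 1 ∈ T ∨ i - 1 ∈ T) → 4 ≤ T.card := by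
  decide +kernel

theorem four_le_card_filter_color {S : Finset (Fin 2 × Fin 8)}
    (hS : ∀ v, ∃ u ∈ S, GP16.Adj v u) (p : Fin 2) :
    4 ≤ (S.filter fun u => ((u.1 : ℕ) + u.2) % 2 = p).card := by
  refine (four_le_card_of_cover p _ fun i => ?_).trans
    (Finset.card_image_le (f := Prod.snd))
  obtain ⟨u, huS, hu⟩ := hS (if (i : ℕ) % 2 = p then 1 else 0, i)
  obtain ⟨hp, hi⟩ := GP16_adj_opposite_color p i u hu
  have hmem : u.2 ∈ (S.filter fun u => ((u.1 : ℕ) + u.2) % 2 = p).image Prod.snd :=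
    Finset.mem_image_of_mem Prod.snd (Finset.mem_filter.2 ⟨huS, hp⟩)
  split_ifs at hi ⊢ <;> rcases hi with h | h | h <;> rw [h] at hmem <;>
    simp only [hmem, true_or, or_true]

theorem eight_le_card_of_total_dominating {S : Finset (Fin 2 × Fin 8)}
    (hS : ∀ v, ∃ u ∈ S, GP16.Adj v u) : 8 ≤ S.card := by
  have hdisj : Disjoint (S.filter fun u => ((u.1 : ℕ) + u.2) % 2 = (0 : Fin 2))
      (S.filter fun u => ((u.1 : ℕ) + u.2) % 2 = (1 : Fin 2)) := by
    rw [Finset.disjoint_filter]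
    intro u _ h0 h1
    simp_all
  have hle := Finset.card_le_card (Finset.union_subset
    (S.filter_subset fun u => ((u.1 : ℕ) + u.2) % 2 = (0 : Fin 2))
    (S.filter_subset fun u => ((u.1 : ℕ) + u.2) % 2 = (1 : Fin 2)))
  rw [Finset.card_union_of_disjoint hdisj] at hle
  linarith [four_le_card_filter_color hS 0, four_le_card_filter_color hS 1]

/-- The generalized Petersen graph `GP(8,3)`, a cubic graph of order 16, has total domination
number 8, exactly one-half its order. -/
theorem totalDominationNumber_GP16 : totalDominationNumber GP16 = 8 := by
  refine IsLeast.csInf_eq ⟨?_, ?_⟩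
  · refine ⟨{(0, 0), (0, 1), (0, 2), (0, 3), (0, 4), (0, 5), (0, 6), (0, 7)},
      by decide, by decide +kernel⟩
  · rintro n ⟨S, rfl, hS⟩
    exact eight_le_card_of_total_dominating hS
end
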